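/- There is a universal constant $C > 0$ such that the following holds (Johnson–Lindenstrauss lemma). Let $v_1, \ldots, v_n \in \mathbb{C}^{d_1}$ be any $n$ vectors and let $0 < \epsilon \leq 1$. If $d_2$ is a positive integer with $d_2 \geq C \epsilon^{-2} \log n$ and $d_2 < d_1$, then there exists a linear transformation $T : \mathbb{C}^{d_1} \to \mathbb{C}^{d_2}$ such that $\|T v_i\|_2 \in [(1-\epsilon)\|v_i\|_2, (1+\epsilon)\|v_i\|_2]$ for all $i \in [n]$. -/

import Mathlib

noncomputable section

/-- The Euclidean (`ℓ₂`) norm of a vector in `ℂ^d`. -/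
def l2norm {d : ℕ} (v : Fin d → ℂ) : ℝ := Real.sqrt (∑ a, ‖v a‖ ^ 2)

/-- Sign attached to a boolean. -/
def jlSign (b : Bool) : ℝ := if b then 1 else -1

/-- Signed sum. -/
def jlA {d : ℕ} (a : Fin d → ℝ) (s : Fin d → Bool) : ℝ := ∑ i, jlSign (s i) * a i

theorem jl_sum_cons {d : ℕ} (f : (Fin (d+1) → Bool) → ℝ) :
    ∑ s, f s = ∑ s : Fin d → Bool, (f (Fin.cons true s) + f (Fin.cons false s)) := by
  rw [← (Fin.consEquiv (fun _ => Bool)).sum_comp f, Fintype.sum_prod_type, Fintype.sum_bool,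
    ← Finset.sum_add_distrib]
  rfl

theorem jlA_cons {d : ℕ} (a : Fin (d+1) → ℝ) (b : Bool) (s : Fin d → Bool) :
    jlA a (Fin.cons b s) = jlSign b * a 0 + jlA (fun i => a i.succ) s := by
  simp [jlA, Fin.sum_univ_succ]

theorem jl_second (d : ℕ) : ∀ (a : Fin d → ℝ) (x : ℝ),
    ∑ s, (x + jlA a s) ^ 2 = 2 ^ d * (x ^ 2 + ∑ i, a i ^ 2) := by
  induction d with
  | zero => intro a x; simp [jlA]
  | succ d ih =>
    intro a x
    rw [jl_sum_cons, Finset.sum_add_distrib]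
    simp only [jlA_cons, ← add_assoc]
    rw [ih, ih, Fin.sum_univ_succ]
    simp only [jlSign]
    simp
    ring

theorem jl_exp_two (μ x a c : ℝ) :
    Real.exp (((x + a) ^ 2 + c) * μ) + Real.exp (((x - a) ^ 2 + c) * μ)
      ≤ 2 * Real.exp ((x ^ 2 + a ^ 2 + c) * μ + 2 * μ ^ 2 * x ^ 2 * a ^ 2) := by
  have h := Real.cosh_le_exp_half_sq (2 * μ * x * a)
  have e1 : ((x + a) ^ 2 + c) * μ = (x ^ 2 + a ^ 2 + c) * μ + 2 * μ * x * a := by ring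
  have e2 : ((x - a) ^ 2 + c) * μ = (x ^ 2 + a ^ 2 + c) * μ + -(2 * μ * x * a) := by ring
  have e3 : (2 * μ * x * a) ^ 2 / 2 = 2 * μ ^ 2 * x ^ 2 * a ^ 2 := by ring
  rw [e3, Real.cosh_eq] at h
  rw [e1, e2, Real.exp_add, Real.exp_add, Real.exp_add]
  have := mul_le_mul_of_nonneg_left h (Real.exp_pos ((x ^ 2 + a ^ 2 + c) * μ)).le
  linarith

theorem jl_mgf (d : ℕ) : ∀ (a : Fin d → ℝ) (x l : ℝ), 0 < l → 2 * l * ∑ i, a i ^ 2 < 1 →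
    ∑ s, Real.exp (l * (x + jlA a s) ^ 2)
      ≤ 2 ^ d * Real.exp ((x ^ 2 + ∑ i, a i ^ 2) * (l / (1 - 2 * l * ∑ i, a i ^ 2))) := by
  induction d with
  | zero => intro a x l hl h; simp [jlA, mul_comm]
  | succ d ih =>
    intro a x l hl h
    rw [jl_sum_cons, Finset.sum_add_distrib]
    simp only [jlA_cons, ← add_assoc]
    rw [Fin.sum_univ_succ] at h ⊢
    set c : ℝ := ∑ i : Fin d, a i.succ ^ 2 with hc
    have hc0 : 0 ≤ c := Finset.sum_nonneg (fun i _ => sq_nonneg _)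
    have ha0 : 0 ≤ a 0 ^ 2 := sq_nonneg _
    have hla : 0 ≤ l * a 0 ^ 2 := by positivity
    have hlc : 2 * l * c < 1 := by nlinarith
    have h1 := ih (fun i => a i.succ) (x + jlSign true * a 0) l hl hlc
    have h2 := ih (fun i => a i.succ) (x + jlSign false * a 0) l hl hlc
    simp only [← hc] at h1 h2
    set μ := l / (1 - 2 * l * c) with hμ
    have hp : 0 < 1 - 2 * l * c := by linarith
    have hq : 0 < 1 - 2 * l * (a 0 ^ 2 + c) := by linarith
    have hμ0 : 0 < μ := div_pos hl hp
    have h3 := jl_exp_two μ x (a 0) c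
    have e1 : x + jlSign true * a 0 = x + a 0 := by simp [jlSign]
    have e2 : x + jlSign false * a 0 = x - a 0 := by simp [jlSign]; ring
    rw [e1] at h1 ⊢
    rw [e2] at h2 ⊢
    have hr : 0 < 1 - 2 * μ * a 0 ^ 2 := by
      have : 1 - 2 * μ * a 0 ^ 2 = (1 - 2 * l * (a 0 ^ 2 + c)) / (1 - 2 * l * c) := by
        rw [hμ]; field_simp; ring
      rw [this]; positivity
    have hν : l / (1 - 2 * l * (a 0 ^ 2 + c)) = μ / (1 - 2 * μ * a 0 ^ 2) := by
      have : 1 - 2 * μ * a 0 ^ 2 = (1 - 2 * l * (a 0 ^ 2 + c)) / (1 - 2 * l * c) := by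
        rw [hμ]; field_simp; ring
      rw [this, hμ, div_div_div_cancel_right₀ hp.ne']
    have hge : μ + 2 * μ ^ 2 * a 0 ^ 2 ≤ μ / (1 - 2 * μ * a 0 ^ 2) := by
      rw [le_div_iff₀ hr]
      have : 0 ≤ 4 * μ ^ 3 * (a 0 ^ 2) ^ 2 := by positivity
      nlinarith
    have h4 : Real.exp ((x ^ 2 + a 0 ^ 2 + c) * μ + 2 * μ ^ 2 * x ^ 2 * a 0 ^ 2)
        ≤ Real.exp ((x ^ 2 + (a 0 ^ 2 + c)) * (l / (1 - 2 * l * (a 0 ^ 2 + c)))) := by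
      apply Real.exp_le_exp.mpr
      rw [hν]
      have k1 := mul_le_mul_of_nonneg_left hge (show 0 ≤ x ^ 2 + (a 0 ^ 2 + c) by positivity)
      have k2 : 0 ≤ 2 * μ ^ 2 * a 0 ^ 2 * (a 0 ^ 2 + c) := by positivity
      nlinarith
    have h5 : (0:ℝ) < 2 ^ d := by positivity
    rw [← add_assoc] at h4 ⊢
    calc _ ≤ _ := add_le_add h1 h2
      _ = 2 ^ d * (Real.exp (((x + a 0) ^ 2 + c) * μ) + Real.exp (((x - a 0) ^ 2 + c) * μ)) := by
        ring
      _ ≤ 2 ^ d * (2 * Real.exp ((x ^ 2 + a 0 ^ 2 + c) * μ + 2 * μ ^ 2 * x ^ 2 * a 0 ^ 2)) := by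
        gcongr
      _ ≤ _ := by
        rw [pow_succ 2 d, mul_assoc (2 ^ d) 2]
        gcongr

/-- Quadratic form. -/
def jlY {d : ℕ} (w : Fin d → ℂ) (s : Fin d → Bool) : ℝ :=
  jlA (fun i => (w i).re) s ^ 2 + jlA (fun i => (w i).im) s ^ 2

theorem jl_split {d : ℕ} (w : Fin d → ℂ) :
    ∑ i, ‖w i‖ ^ 2 = ∑ i, (w i).re ^ 2 + ∑ i, (w i).im ^ 2 := by
  rw [← Finset.sum_add_distrib]
  refine Finset.sum_congr rfl fun i _ => ?_
  rw [Complex.sq_norm, Complex.normSq_apply]; ring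

theorem jlY_mean {d : ℕ} (w : Fin d → ℂ) (hw : ∑ i, ‖w i‖ ^ 2 = 1) :
    ∑ s, jlY w s = 2 ^ d := by
  have h1 := jl_second d (fun i => (w i).re) 0
  have h2 := jl_second d (fun i => (w i).im) 0
  simp only [zero_add] at h1 h2
  rw [jl_split] at hw
  simp only [jlY]
  rw [Finset.sum_add_distrib, h1, h2]
  linear_combination (2:ℝ) ^ d * hw

theorem jl_mgf' {d : ℕ} (a : Fin d → ℝ) (h : ∑ i, a i ^ 2 ≤ 1) :
    ∑ s, Real.exp (1 / 4 * jlA a s ^ 2) ≤ 2 ^ d * Real.exp (1 / 2) := by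
  have h0 : 0 ≤ ∑ i, a i ^ 2 := Finset.sum_nonneg (fun i _ => sq_nonneg _)
  have h1 := jl_mgf d a 0 (1/4) (by norm_num) (by linarith)
  simp only [zero_add] at h1
  refine h1.trans ?_
  gcongr
  set c := ∑ i, a i ^ 2
  rw [← mul_div_assoc, div_le_iff₀ (by linarith)]
  nlinarith

theorem jlY_exp {d : ℕ} (w : Fin d → ℂ) (hw : ∑ i, ‖w i‖ ^ 2 = 1) :
    ∑ s, Real.exp (1 / 8 * jlY w s) ≤ 2 ^ d * Real.exp (1 / 2) := by
  rw [jl_split] at hw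
  have p1 : 0 ≤ ∑ i, (w i).re ^ 2 := Finset.sum_nonneg (fun i _ => sq_nonneg _)
  have p2 : 0 ≤ ∑ i, (w i).im ^ 2 := Finset.sum_nonneg (fun i _ => sq_nonneg _)
  have h1 := jl_mgf' (fun i => (w i).re) (by linarith)
  have h2 := jl_mgf' (fun i => (w i).im) (by linarith)
  have : ∀ s : Fin d → Bool, Real.exp (1 / 8 * jlY w s) ≤
      1 / 2 * Real.exp (1 / 4 * jlA (fun i => (w i).re) s ^ 2)
      + 1 / 2 * Real.exp (1 / 4 * jlA (fun i => (w i).im) s ^ 2) := by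
    intro s
    have e : ∀ u v : ℝ, Real.exp (1 / 8 * (u + v)) ≤
        1 / 2 * Real.exp (1 / 4 * u) + 1 / 2 * Real.exp (1 / 4 * v) := by
      intro u v
      have e1 : 1 / 8 * (u + v) = 1 / 8 * u + 1 / 8 * v := by ring
      have e2 : 1 / 4 * u = 1 / 8 * u + 1 / 8 * u := by ring
      have e3 : 1 / 4 * v = 1 / 8 * v + 1 / 8 * v := by ring
      rw [e1, e2, e3, Real.exp_add, Real.exp_add, Real.exp_add]
      nlinarith [sq_nonneg (Real.exp (1 / 8 * u) - Real.exp (1 / 8 * v))]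
    exact e _ _
  calc _ ≤ _ := Finset.sum_le_sum (fun s _ => this s)
    _ ≤ _ := by
      rw [Finset.sum_add_distrib, ← Finset.mul_sum, ← Finset.mul_sum]
      linarith

theorem jl_exp_le (x : ℝ) : Real.exp x ≤ 1 + x + x ^ 2 * Real.exp |x| := by
  have h := Complex.norm_exp_sub_sum_le_norm_mul_exp (x : ℂ) 2
  simp only [Finset.sum_range_succ, Finset.sum_range_zero] at h
  have e : Complex.exp (x:ℂ) - (0 + (x:ℂ) ^ 0 / (Nat.factorial 0 : ℂ)
      + (x:ℂ) ^ 1 / (Nat.factorial 1 : ℂ)) = ((Real.exp x - (1 + x) : ℝ) : ℂ) := by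
    push_cast; simp
  rw [e, Complex.norm_real, Complex.norm_real, Real.norm_eq_abs, Real.norm_eq_abs, sq_abs] at h
  linarith [le_abs_self (Real.exp x - (1 + x))]

theorem jl_pointwise (Y l : ℝ) (hY : 0 ≤ Y) (hl : |l| ≤ 1 / 16) :
    Real.exp (l * (Y - 1)) ≤ 1 + l * (Y - 1)
      + l ^ 2 * (512 * Real.exp (1 / 8) * Real.exp (1 / 8 * Y)) := by
  have h := jl_exp_le (l * (Y - 1))
  have hz : |Y - 1| ≤ Y + 1 := by rw [abs_le]; constructor <;> linarith
  have h1 : |l * (Y - 1)| ≤ (Y + 1) / 16 := by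
    rw [abs_mul]
    have := mul_le_mul hl hz (abs_nonneg _) (by norm_num)
    linarith
  have h2 : (Y - 1) ^ 2 ≤ 512 * Real.exp ((Y + 1) / 16) := by
    have := Real.quadratic_le_exp_of_nonneg (x := (Y + 1) / 16) (by positivity)
    nlinarith
  have h3 : Real.exp (1 / 8) * Real.exp (1 / 8 * Y)
      = Real.exp ((Y + 1) / 16) * Real.exp ((Y + 1) / 16) := by
    rw [← Real.exp_add, ← Real.exp_add]; congr 1; ring
  have h4 : (Y - 1) ^ 2 * Real.exp |l * (Y - 1)|
      ≤ 512 * Real.exp ((Y + 1) / 16) * Real.exp ((Y + 1) / 16) := by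
    gcongr
  have h5 := mul_le_mul_of_nonneg_left h4 (sq_nonneg l)
  have h6 : l ^ 2 * (512 * Real.exp (1 / 8) * Real.exp (1 / 8 * Y)) =
    l ^ 2 * (512 * Real.exp ((Y + 1) / 16) * Real.exp ((Y + 1) / 16)) := by
    linear_combination l ^ 2 * 512 * h3
  rw [h6]
  refine h.trans ?_
  linarith [mul_pow l (Y - 1) 2]

theorem jl_row {d : ℕ} (w : Fin d → ℂ) (hw : ∑ i, ‖w i‖ ^ 2 = 1) (l : ℝ) (hl : |l| ≤ 1 / 16) :
    ∑ s, Real.exp (l * (jlY w s - 1)) ≤ 2 ^ d * Real.exp (2048 * l ^ 2) := by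
  have hpt : ∀ s, Real.exp (l * (jlY w s - 1)) ≤ _ := fun s =>
    jl_pointwise (jlY w s) l (by unfold jlY; positivity) hl
  have hm := jlY_mean w hw
  have he := jlY_exp w hw
  refine (Finset.sum_le_sum (fun s _ => hpt s)).trans ?_
  have e : ∑ s, (1 + l * (jlY w s - 1)
      + l ^ 2 * (512 * Real.exp (1 / 8) * Real.exp (1 / 8 * jlY w s))) =
      2 ^ d + l * (∑ s, jlY w s - 2 ^ d)
        + l ^ 2 * (512 * Real.exp (1 / 8) * ∑ s, Real.exp (1 / 8 * jlY w s)) := by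
    simp only [Finset.sum_add_distrib, ← Finset.mul_sum, Finset.sum_sub_distrib]
    simp
  rw [e, hm, sub_self, mul_zero, add_zero]
  have h1 : Real.exp (1 / 8) * Real.exp (1 / 2) ≤ 3 := by
    rw [← Real.exp_add]
    have := Real.exp_one_lt_d9
    have h2 : Real.exp (1 / 8 + 1 / 2) ≤ Real.exp 1 := Real.exp_le_exp.mpr (by norm_num)
    linarith
  have h2 : l ^ 2 * (512 * Real.exp (1 / 8) * ∑ s, Real.exp (1 / 8 * jlY w s))
      ≤ l ^ 2 * (512 * Real.exp (1 / 8) * (2 ^ d * Real.exp (1 / 2))) := by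
    gcongr
  have h3 : l ^ 2 * (512 * 2 ^ d) * (Real.exp (1 / 8) * Real.exp (1 / 2))
      ≤ l ^ 2 * (512 * 2 ^ d) * 3 := by gcongr
  have h4 := mul_le_mul_of_nonneg_left (Real.add_one_le_exp (2048 * l ^ 2))
    (show (0:ℝ) ≤ 2 ^ d by positivity)
  have h5 : (0:ℝ) ≤ 2 ^ d * l ^ 2 := by positivity
  nlinarith

theorem jl_tail {d m : ℕ} (w : Fin d → ℂ) (hw : ∑ i, ‖w i‖ ^ 2 = 1) (l : ℝ)
    (hl : |l| ≤ 1 / 16) (t : ℝ) :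
    ∑ S : Fin m → (Fin d → Bool), Real.exp (l * (∑ j, jlY w (S j) - m) - m * t)
      ≤ (2 ^ d) ^ m * Real.exp (m * (2048 * l ^ 2 - t)) := by
  have h := pow_le_pow_left₀ (Finset.sum_nonneg (fun s _ => (Real.exp_pos _).le))
    (jl_row w hw l hl) m
  rw [Fintype.sum_pow, mul_pow, ← Real.exp_nat_mul] at h
  have e : ∀ S : Fin m → (Fin d → Bool),
      Real.exp (l * (∑ j, jlY w (S j) - m) - m * t)
      = (∏ j, Real.exp (l * (jlY w (S j) - 1))) * Real.exp (-(m * t)) := by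
    intro S
    rw [← Real.exp_sum, ← Real.exp_add, ← Finset.mul_sum, Finset.sum_sub_distrib]
    congr 1
    simp
    ring
  simp only [e]
  rw [← Finset.sum_mul, mul_sub, sub_eq_add_neg, Real.exp_add, ← mul_assoc]
  gcongr

theorem jl_exists {d m n : ℕ} (w : Fin n → Fin d → ℂ) (hw : ∀ k, ∑ i, ‖w k i‖ ^ 2 = 1)
    (ε : ℝ) (hε : 0 < ε) (hε1 : ε ≤ 1) (hn : 2 ≤ n)
    (hm : 3 * Real.log n ≤ m * ε ^ 2 / 8192) :
    ∃ S : Fin m → (Fin d → Bool), ∀ k,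
      m * (1 - ε) ≤ ∑ j, jlY (w k) (S j) ∧ ∑ j, jlY (w k) (S j) ≤ m * (1 + ε) := by
  set l := ε / 4096 with hl
  have hl0 : 0 < l := by positivity
  have hlb : |l| ≤ 1 / 16 := by rw [abs_of_pos hl0, hl]; linarith
  have hlb' : |-l| ≤ 1 / 16 := by rwa [abs_neg]
  set F : (Fin m → (Fin d → Bool)) → Fin n → ℝ := fun S k =>
    Real.exp (l * (∑ j, jlY (w k) (S j) - m) - m * (l * ε))
    + Real.exp (-l * (∑ j, jlY (w k) (S j) - m) - m * (l * ε)) with hF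
  have hn0 : (0:ℝ) < n := by positivity
  have hn2 : (2:ℝ) ≤ n := by exact_mod_cast hn
  have hexp : Real.exp (m * (2048 * l ^ 2 - l * ε)) ≤ ((n:ℝ) ^ 3)⁻¹ := by
    have e : m * (2048 * l ^ 2 - l * ε) = -(m * ε ^ 2 / 8192) := by rw [hl]; ring
    rw [e, ← Real.exp_log (show 0 < ((n:ℝ) ^ 3)⁻¹ by positivity), Real.log_inv, Real.log_pow]
    apply Real.exp_le_exp.mpr
    push_cast
    linarith
  have hk : ∀ k, ∑ S, F S k ≤ (2 ^ d) ^ m * (2 * ((n:ℝ) ^ 3)⁻¹) := by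
    intro k
    simp only [hF]
    rw [Finset.sum_add_distrib]
    have h1 := jl_tail (m := m) (w k) (hw k) l hlb (l * ε)
    have h2 := jl_tail (m := m) (w k) (hw k) (-l) hlb' (l * ε)
    rw [neg_sq] at h2
    have h3 := mul_le_mul_of_nonneg_left hexp (show (0:ℝ) ≤ (2 ^ d) ^ m by positivity)
    linarith
  have hsum : ∑ S, ∑ k, F S k < ∑ S : Fin m → (Fin d → Bool), (1:ℝ) := by
    rw [Finset.sum_comm]
    have h1 := Finset.sum_le_sum (s := Finset.univ) (fun k _ => hk k)
    refine h1.trans_lt ?_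
    simp only [Finset.sum_const, Finset.card_univ, Fintype.card_fun, Fintype.card_fin,
      Fintype.card_bool, nsmul_eq_mul, mul_one]
    push_cast
    have h2 : (n:ℝ) * (2 * ((n:ℝ) ^ 3)⁻¹) < 1 := by
      have : (n:ℝ) * (2 * ((n:ℝ) ^ 3)⁻¹) = 2 / (n:ℝ) ^ 2 := by field_simp
      rw [this, div_lt_one (by positivity)]
      nlinarith
    have h3 : (0:ℝ) < (2 ^ d) ^ m := by positivity
    nlinarith
  obtain ⟨S, -, hS⟩ := Finset.exists_lt_of_sum_lt hsum
  refine ⟨S, fun k => ?_⟩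
  have hpos : ∀ k, 0 ≤ F S k := fun k => by simp only [hF]; positivity
  have h1 : F S k < 1 :=
    (Finset.single_le_sum (fun k _ => hpos k) (Finset.mem_univ k)).trans_lt hS
  simp only [hF] at h1
  set Q := ∑ j, jlY (w k) (S j)
  have p1 := Real.exp_pos (l * (Q - m) - m * (l * ε))
  have p2 := Real.exp_pos (-l * (Q - m) - m * (l * ε))
  have q1 := Real.exp_lt_one_iff.mp (show Real.exp (l * (Q - m) - m * (l * ε)) < 1 by linarith)
  have q2 := Real.exp_lt_one_iff.mp (show Real.exp (-l * (Q - m) - m * (l * ε)) < 1 by linarith)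
  constructor
  · by_contra hc
    push Not at hc
    nlinarith
  · by_contra hc
    push Not at hc
    nlinarith

/-- Scaled sign matrix as a linear map. -/
def jlT {d m : ℕ} (S : Fin m → (Fin d → Bool)) : (Fin d → ℂ) →ₗ[ℂ] (Fin m → ℂ) :=
  Matrix.mulVecLin (Matrix.of fun j i => (((Real.sqrt m)⁻¹ * jlSign (S j i) : ℝ) : ℂ))

theorem jlT_norm {d m : ℕ} (S : Fin m → (Fin d → Bool)) (w : Fin d → ℂ) :
    l2norm (jlT S w) = Real.sqrt ((m:ℝ)⁻¹ * ∑ j, jlY w (S j)) := by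
  unfold l2norm
  rw [Finset.mul_sum]
  congr 1
  refine Finset.sum_congr rfl fun j _ => ?_
  have e : jlT S w j = (((Real.sqrt m)⁻¹ : ℝ) : ℂ) *
      ((jlA (fun i => (w i).re) (S j) : ℂ) + (jlA (fun i => (w i).im) (S j) : ℂ) * Complex.I) := by
    simp only [jlT, Matrix.mulVecLin_apply, Matrix.mulVec, dotProduct, Matrix.of_apply, jlA]
    push_cast
    rw [Finset.sum_mul, ← Finset.sum_add_distrib, Finset.mul_sum]
    refine Finset.sum_congr rfl fun i _ => ?_
    conv_lhs => rw [← Complex.re_add_im (w i)]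
    ring
  rw [e, norm_mul, mul_pow, Complex.norm_real, Complex.sq_norm (_ + _), Complex.normSq_add_mul_I,
    Real.norm_eq_abs, sq_abs, inv_pow, Real.sq_sqrt (Nat.cast_nonneg m)]
  rfl

theorem l2norm_smul {d : ℕ} (r : ℝ) (hr : 0 ≤ r) (w : Fin d → ℂ) :
    l2norm ((r : ℂ) • w) = r * l2norm w := by
  unfold l2norm
  simp only [Pi.smul_apply, smul_eq_mul, norm_mul, mul_pow, ← Finset.mul_sum]
  rw [Real.sqrt_mul (by positivity), Real.sqrt_sq (norm_nonneg _), Complex.norm_real,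
    Real.norm_of_nonneg hr]

theorem l2norm_zero {d : ℕ} : l2norm (0 : Fin d → ℂ) = 0 := by simp [l2norm]

theorem l2norm_nonneg {d : ℕ} (v : Fin d → ℂ) : 0 ≤ l2norm v := Real.sqrt_nonneg _

theorem l2norm_eq_zero {d : ℕ} (v : Fin d → ℂ) (h : l2norm v = 0) : v = 0 := by
  unfold l2norm at h
  rw [Real.sqrt_eq_zero (by positivity),
    Finset.sum_eq_zero_iff_of_nonneg (fun i _ => by positivity)] at h
  ext i
  simpa using h i (Finset.mem_univ i)

theorem jl_normalize {d : ℕ} (hd : 0 < d) (v : Fin d → ℂ) :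
    ∃ w : Fin d → ℂ, ∑ i, ‖w i‖ ^ 2 = 1 ∧ v = ((l2norm v : ℝ) : ℂ) • w := by
  by_cases h : l2norm v = 0
  · refine ⟨Pi.single ⟨0, hd⟩ 1, ?_, ?_⟩
    · rw [Finset.sum_eq_single ⟨0, hd⟩]
      · simp
      · intro b _ hb; simp [hb]
      · simp
    · rw [h, l2norm_eq_zero v h]; simp
  · refine ⟨(((l2norm v)⁻¹ : ℝ) : ℂ) • v, ?_, ?_⟩
    · have h1 := l2norm_smul (l2norm v)⁻¹ (inv_nonneg.mpr (l2norm_nonneg v)) v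
      rw [inv_mul_cancel₀ h] at h1
      unfold l2norm at h1 ⊢
      exact Real.sqrt_eq_one.mp h1
    · rw [smul_smul, ← Complex.ofReal_mul, mul_inv_cancel₀ h]; simp

theorem jl_single {d m : ℕ} (hm : 0 < m) (v : Fin d → ℂ) :
    ∃ T : (Fin d → ℂ) →ₗ[ℂ] (Fin m → ℂ), l2norm (T v) = l2norm v := by
  by_cases h : v = 0
  · exact ⟨0, by simp [h, l2norm_zero]⟩
  · obtain ⟨a, ha⟩ := Function.ne_iff.mp h
    refine ⟨(LinearMap.single ℂ (fun _ : Fin m => ℂ) ⟨0, hm⟩).comp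
      (((l2norm v : ℂ) / v a) • LinearMap.proj a), ?_⟩
    have e : ((LinearMap.single ℂ (fun _ : Fin m => ℂ) ⟨0, hm⟩).comp
      (((l2norm v : ℂ) / v a) • LinearMap.proj a)) v
      = ((l2norm v : ℝ) : ℂ) • (Pi.single ⟨0, hm⟩ 1 : Fin m → ℂ) := by
      have ha' : v a ≠ 0 := ha
      ext j
      by_cases hj : j = ⟨0, hm⟩
      · subst hj; simp [ha']
      · simp [hj]
    rw [e, l2norm_smul _ (l2norm_nonneg v)]
    have : l2norm (Pi.single ⟨0, hm⟩ 1 : Fin m → ℂ) = 1 := by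
      unfold l2norm
      rw [Finset.sum_eq_single ⟨0, hm⟩]
      · simp
      · intro b _ hb; simp [hb]
      · simp
    rw [this, mul_one]

/-- **Johnson–Lindenstrauss lemma.** There is a universal constant `C > 0` such that for any
`n` vectors `v₁, ..., vₙ ∈ ℂ^{d₁}` and any `0 < ε ≤ 1`, if `d₂` is a positive integer with
`d₂ ≥ C ε⁻² log n` and `d₂ < d₁`, then there is a linear map `T : ℂ^{d₁} → ℂ^{d₂}` with
`‖T vᵢ‖₂ ∈ [(1-ε)‖vᵢ‖₂, (1+ε)‖vᵢ‖₂]` for all `i`. -/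
theorem johnson_lindenstrauss :
    ∃ C : ℝ, 0 < C ∧
      ∀ (d1 d2 n : ℕ) (v : Fin n → (Fin d1 → ℂ)) (ε : ℝ),
        0 < ε → ε ≤ 1 → 0 < d2 →
        C * ε⁻¹ ^ 2 * Real.log n ≤ (d2 : ℝ) → d2 < d1 →
        ∃ T : (Fin d1 → ℂ) →ₗ[ℂ] (Fin d2 → ℂ),
          ∀ i : Fin n,
            (1 - ε) * l2norm (v i) ≤ l2norm (T (v i)) ∧
            l2norm (T (v i)) ≤ (1 + ε) * l2norm (v i) := by
  refine ⟨24576, by norm_num, ?_⟩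
  intro d1 d2 n v ε hε hε1 hd2 hC hd
  rcases Nat.lt_or_ge n 2 with hn | hn
  · rcases Nat.eq_zero_or_pos n with h0 | h0
    · subst h0
      exact ⟨0, fun i => i.elim0⟩
    · obtain rfl : n = 1 := by omega
      obtain ⟨T, hT⟩ := jl_single hd2 (v 0)
      refine ⟨T, fun i => ?_⟩
      obtain rfl : i = 0 := Subsingleton.elim _ _
      rw [hT]
      have := l2norm_nonneg (v 0)
      constructor <;> nlinarith
  · choose w hw hvw using fun i => jl_normalize (show 0 < d1 by omega) (v i)
    have hm : 3 * Real.log n ≤ d2 * ε ^ 2 / 8192 := by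
      have h1 := mul_le_mul_of_nonneg_right hC (sq_nonneg ε)
      have h2 : 24576 * ε⁻¹ ^ 2 * Real.log n * ε ^ 2 = 24576 * Real.log n := by
        field_simp
      rw [h2] at h1
      linarith
    obtain ⟨S, hS⟩ := jl_exists w hw ε hε hε1 hn hm
    have hd2' : (0:ℝ) < d2 := by exact_mod_cast hd2
    refine ⟨jlT S, fun i => ?_⟩
    have hr := l2norm_nonneg (v i)
    have hT : l2norm (jlT S (v i)) = l2norm (v i) * l2norm (jlT S (w i)) := by
      conv_lhs => rw [hvw i, map_smul, l2norm_smul _ hr]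
    obtain ⟨hlo, hhi⟩ := hS i
    rw [hT, jlT_norm]
    set Q := ∑ j, jlY (w i) (S j)
    have q1 : 1 - ε ≤ (d2:ℝ)⁻¹ * Q := by
      rw [inv_mul_eq_div, le_div_iff₀ hd2']; linarith
    have q2 : (d2:ℝ)⁻¹ * Q ≤ 1 + ε := by
      rw [inv_mul_eq_div, div_le_iff₀ hd2']; linarith
    have s1 : 1 - ε ≤ Real.sqrt ((d2:ℝ)⁻¹ * Q) := by
      apply Real.le_sqrt_of_sq_le
      nlinarith
    have s2 : Real.sqrt ((d2:ℝ)⁻¹ * Q) ≤ 1 + ε := by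
      rw [Real.sqrt_le_left (by linarith)]
      nlinarith
    constructor <;> nlinarith
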